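/- arXiv:1905.07554 — 5 statements merged into one kernel-verified Lean document; each statement's English description precedes it below -/
import Mathlib

section
/- (Lazard elimination, decomposition part.) Let K be a field and let X, Y be types. In the free Lie algebra L = FreeLieAlgebra K (X ⊕ Y), let S be the Lie subalgebra generated by the image of Y under the canonical inclusion ι ∘ Sum.inr, and let I be the Lie ideal generated by the image of X under ι ∘ Sum.inl. Then L is the internal direct sum of S and I as K-vector spaces: the underlying submodules satisfy S ⊓ I = ⊥ and S ⊔ I = ⊤. -/
theorem stmt11 (K : Type*) [Field K] (X Y : Type*)
    (S : LieSubalgebra K (FreeLieAlgebra K (X ⊕ Y)))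
    (hS : S = LieSubalgebra.lieSpan K (FreeLieAlgebra K (X ⊕ Y))
      (Set.range fun y : Y => FreeLieAlgebra.of K (Sum.inr y)))
    (I : LieIdeal K (FreeLieAlgebra K (X ⊕ Y)))
    (hI : I = LieSubmodule.lieSpan K (FreeLieAlgebra K (X ⊕ Y))
      (Set.range fun x : X => FreeLieAlgebra.of K (Sum.inl x))) :
    S.toSubmodule ⊓ I.toSubmodule = ⊥ ∧ S.toSubmodule ⊔ I.toSubmodule = ⊤ := by
  have hy : ∀ y : Y, FreeLieAlgebra.of K (Sum.inr y) ∈ S := fun y => by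
    rw [hS]; exact LieSubalgebra.subset_lieSpan ⟨y, rfl⟩
  have hx : ∀ x : X, FreeLieAlgebra.of K (Sum.inl x) ∈ I := fun x => by
    rw [hI]; exact LieSubmodule.subset_lieSpan ⟨x, rfl⟩
  let ψ : FreeLieAlgebra K (X ⊕ Y) →ₗ⁅K⁆ S :=
    FreeLieAlgebra.lift K (Sum.elim (fun _ => 0) (fun y => ⟨_, hy y⟩))
  let φ : FreeLieAlgebra K (X ⊕ Y) →ₗ⁅K⁆ FreeLieAlgebra K (X ⊕ Y) := S.incl.comp ψ
  have φx : ∀ x : X, φ (FreeLieAlgebra.of K (Sum.inl x)) = 0 := fun x => by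
    simp [φ, ψ]
  have φy : ∀ y : Y, φ (FreeLieAlgebra.of K (Sum.inr y)) = FreeLieAlgebra.of K (Sum.inr y) :=
    fun y => by simp [φ, ψ]
  have φmem : ∀ a, φ a ∈ S := fun a => (ψ a).2
  have φI : I ≤ φ.ker := by
    rw [hI, LieSubmodule.lieSpan_le]
    rintro _ ⟨x, rfl⟩
    exact (LieHom.mem_ker).2 (φx x)
  have φS : ∀ a ∈ S, φ a = a := by
    intro a ha
    rw [hS] at ha
    induction ha using LieSubalgebra.lieSpan_induction with
    | mem a h => obtain ⟨y, rfl⟩ := h; exact φy y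
    | zero => simp
    | add a b _ _ h1 h2 => rw [map_add, h1, h2]
    | smul t a _ h => rw [map_smul, h]
    | lie a b _ _ h1 h2 => rw [LieHom.map_lie, h1, h2]
  constructor
  · rw [eq_bot_iff]
    rintro a ⟨h1, h2⟩
    have := (LieHom.mem_ker).1 (φI h2)
    rw [φS a h1] at this
    exact this
  · rw [eq_top_iff]
    rintro a -
    have key : (LieSubmodule.Quotient.mk' I : _ →ₗ⁅K,_⁆ _) a
        = (LieSubmodule.Quotient.mk' I : _ →ₗ⁅K,_⁆ _) (φ a) := by
      let q : FreeLieAlgebra K (X ⊕ Y) →ₗ⁅K⁆ (FreeLieAlgebra K (X ⊕ Y) ⧸ I) :=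
        { (LieSubmodule.Quotient.mk' I : _ →ₗ[K] _) with
          map_lie' := fun {x y} => LieSubmodule.Quotient.mk_bracket I x y }
      have : q = q.comp φ := by
        ext z
        rcases z with x | y
        · rw [LieHom.comp_apply, φx, map_zero]
          exact (LieSubmodule.Quotient.mk_eq_zero I).2 (hx x)
        · rw [LieHom.comp_apply, φy]
      exact congrArg (fun f => f a) this
    have h : a - φ a ∈ I := by
      rw [← LieSubmodule.Quotient.mk_eq_zero, map_sub, key, sub_self]
    rw [Submodule.mem_sup]
    exact ⟨φ a, φmem a, a - φ a, h, by abel⟩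
end

section
/- Let K be a field and let X, Y be types. In the free Lie algebra L = FreeLieAlgebra K (X ⊕ Y), let I be the Lie ideal generated by the image of X under ι ∘ Sum.inl. Then the Lie algebra morphism FreeLieAlgebra K Y → L/I obtained from the universal property by sending each y ∈ Y to the class of ι(Sum.inr y) is a Lie algebra isomorphism (it is bijective). -/
theorem stmt12 (K : Type*) [Field K] (X Y : Type*)
    (I : LieIdeal K (FreeLieAlgebra K (X ⊕ Y)))
    (hI : I = LieSubmodule.lieSpan K (FreeLieAlgebra K (X ⊕ Y))
      (Set.range fun x : X => FreeLieAlgebra.of K (Sum.inl x))) :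
    Function.Bijective
      (FreeLieAlgebra.lift K
        (fun y : Y =>
          (LieSubmodule.Quotient.mk (N := I) (FreeLieAlgebra.of K (Sum.inr y)) :
            FreeLieAlgebra K (X ⊕ Y) ⧸ I))) := by
  set φ := FreeLieAlgebra.lift K
        (fun y : Y =>
          (LieSubmodule.Quotient.mk (N := I) (FreeLieAlgebra.of K (Sum.inr y)) :
            FreeLieAlgebra K (X ⊕ Y) ⧸ I)) with hφ
  let q : FreeLieAlgebra K (X ⊕ Y) →ₗ⁅K⁆ (FreeLieAlgebra K (X ⊕ Y) ⧸ I) :=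
    { (LieSubmodule.Quotient.mk' I : FreeLieAlgebra K (X ⊕ Y) →ₗ[K] _) with
      map_lie' := fun {x y} => LieSubmodule.Quotient.mk_bracket I x y }
  have hq : ∀ a, q a = LieSubmodule.Quotient.mk a := fun a => rfl
  let s : FreeLieAlgebra K Y →ₗ⁅K⁆ FreeLieAlgebra K (X ⊕ Y) :=
    FreeLieAlgebra.lift K (fun y => FreeLieAlgebra.of K (Sum.inr y))
  let p : FreeLieAlgebra K (X ⊕ Y) →ₗ⁅K⁆ FreeLieAlgebra K Y :=
    FreeLieAlgebra.lift K (Sum.elim (fun _ => 0) (FreeLieAlgebra.of K))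
  have h1 : φ = q.comp s := by
    apply FreeLieAlgebra.hom_ext
    intro y
    simp [hφ, s, hq, FreeLieAlgebra.lift_of_apply]
  have h2 : p.comp s = LieHom.id := by
    apply FreeLieAlgebra.hom_ext
    intro y
    simp [p, s, FreeLieAlgebra.lift_of_apply]
  have h3 : I ≤ p.ker := by
    rw [hI, LieSubmodule.lieSpan_le]
    rintro _ ⟨x, rfl⟩
    simp [p, FreeLieAlgebra.lift_of_apply]
  have h4 : φ.comp p = q := by
    apply FreeLieAlgebra.hom_ext
    rintro (x | y)
    · have hx : q (FreeLieAlgebra.of K (Sum.inl x)) = 0 := by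
        rw [hq, LieSubmodule.Quotient.mk_eq_zero', hI]
        exact LieSubmodule.subset_lieSpan ⟨x, rfl⟩
      rw [hx]
      simp [p, FreeLieAlgebra.lift_of_apply]
    · simp [p, hφ, hq, FreeLieAlgebra.lift_of_apply]
  constructor
  · rw [injective_iff_map_eq_zero]
    intro a ha
    rw [h1, LieHom.comp_apply, hq, LieSubmodule.Quotient.mk_eq_zero'] at ha
    have h5 := (LieHom.mem_ker).1 (h3 ha)
    have h6 := LieHom.congr_fun h2 a
    rw [LieHom.comp_apply, h5] at h6
    exact h6.symm
  · intro b
    obtain ⟨a, rfl⟩ := LieSubmodule.Quotient.surjective_mk' I b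
    exact ⟨p a, LieHom.congr_fun h4 a⟩
end

section
/- (Lazard elimination, freeness of the ideal.) Let K be a field and let X, Y be types. Let W be the type Σ (n : ℕ), (Fin n → Y) × X, and consider the Lie algebra morphism φ : FreeLieAlgebra K W → FreeLieAlgebra K (X ⊕ Y) obtained from the universal property by sending ((y₁,…,y_n), x) to the iterated bracket ⁅ι(Sum.inr y₁), ⁅ι(Sum.inr y₂), …, ⁅ι(Sum.inr y_n), ι(Sum.inl x)⁆…⁆⁆ (which is ι(Sum.inl x) when n = 0). Then φ is injective and its range is exactly the Lie ideal generated by the image of X under ι ∘ Sum.inl; i.e., that ideal is a free Lie algebra on the brackets ⁅y₁,…,y_n, x⁆. -/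
/-- The iterated bracket `⁅of (inr y₁), ⁅of (inr y₂), …, ⁅of (inr yₙ), of (inl x)⁆…⁆⁆`
in the free Lie algebra on `X ⊕ Y`. -/
noncomputable def iterBracket (K : Type*) [Field K] (X Y : Type*) :
    (n : ℕ) → (Fin n → Y) → X → FreeLieAlgebra K (X ⊕ Y)
  | 0, _, x => FreeLieAlgebra.of K (Sum.inl x)
  | n + 1, ys, x =>
      ⁅FreeLieAlgebra.of K ((Sum.inr (ys 0) : X ⊕ Y)), iterBracket K X Y n (fun i => ys i.succ) x⁆

namespace LazardElim

/-- Dual-number extension of a Lie algebra. -/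
@[ext] structure DL (L : Type*) where
  fst : L
  snd : L

namespace DL
variable {K L : Type*} [Field K] [LieRing L] [LieAlgebra K L]

def toProd : DL L ≃ L × L where
  toFun x := ⟨x.fst, x.snd⟩
  invFun x := ⟨x.1, x.2⟩
  left_inv _ := rfl
  right_inv _ := rfl

instance : AddCommGroup (DL L) := toProd.addCommGroup
instance : Module K (DL L) := toProd.module K
instance : Bracket (DL L) (DL L) where
  bracket x y := ⟨⁅x.fst, y.fst⁆, ⁅x.fst, y.snd⁆ + ⁅x.snd, y.fst⁆⟩

theorem zero_eq : (0 : DL L) = ⟨0, 0⟩ := rfl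
theorem add_eq (x y : DL L) : x + y = ⟨x.fst + y.fst, x.snd + y.snd⟩ := rfl
theorem smul_eq (t : K) (x : DL L) : t • x = ⟨t • x.fst, t • x.snd⟩ := rfl
theorem lie_eq (x y : DL L) :
    ⁅x, y⁆ = ⟨⁅x.fst, y.fst⁆, ⁅x.fst, y.snd⁆ + ⁅x.snd, y.fst⁆⟩ := rfl

instance : LieRing (DL L) where
  add_lie _ _ _ := by simp only [lie_eq, add_eq, add_lie, DL.mk.injEq, true_and]; abel
  lie_add _ _ _ := by simp only [lie_eq, add_eq, lie_add, DL.mk.injEq, true_and]; abel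
  lie_self x := by
    simp only [lie_eq, zero_eq, lie_self, DL.mk.injEq, true_and]
    rw [← lie_skew x.fst x.snd]; exact neg_add_cancel _
  leibniz_lie x y z := by
    simp only [lie_eq, add_eq, lie_add, add_lie, DL.mk.injEq]
    refine ⟨leibniz_lie _ _ _, ?_⟩
    rw [leibniz_lie x.fst y.fst z.snd, leibniz_lie x.fst y.snd z.fst,
      leibniz_lie x.snd y.fst z.fst]
    abel

instance : LieAlgebra K (DL L) where
  lie_smul _ _ _ := by simp only [lie_eq, smul_eq, lie_smul, smul_add]

def fstHom : DL L →ₗ⁅K⁆ L where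
  toFun x := x.fst
  map_add' _ _ := rfl
  map_smul' _ _ := rfl
  map_lie' := rfl

def sndLin : DL L →ₗ[K] L where
  toFun x := x.snd
  map_add' _ _ := rfl
  map_smul' _ _ := rfl

end DL

variable {K : Type*} [Field K]

/-- The derivation of a free Lie algebra with prescribed values on generators. -/
noncomputable def liftHom {Z : Type*} (f : Z → FreeLieAlgebra K Z) :
    FreeLieAlgebra K Z →ₗ⁅K⁆ DL (FreeLieAlgebra K Z) :=
  FreeLieAlgebra.lift K (fun z => (⟨FreeLieAlgebra.of K z, f z⟩ : DL (FreeLieAlgebra K Z)))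

theorem liftHom_fst {Z : Type*} (f : Z → FreeLieAlgebra K Z) (a : FreeLieAlgebra K Z) :
    (liftHom f a).fst = a := by
  have h : (DL.fstHom (K := K)).comp (liftHom f) = LieHom.id := by
    apply FreeLieAlgebra.hom_ext
    intro z
    rw [LieHom.comp_apply, liftHom, FreeLieAlgebra.lift_of_apply]
    rfl
  exact LieHom.congr_fun h a

noncomputable def der {Z : Type*} (f : Z → FreeLieAlgebra K Z) :
    LieDerivation K (FreeLieAlgebra K Z) (FreeLieAlgebra K Z) where
  toLinearMap := DL.sndLin.comp (liftHom f : FreeLieAlgebra K Z →ₗ[K] DL (FreeLieAlgebra K Z))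
  leibniz' a b := by
    change (liftHom f ⁅a, b⁆).snd = ⁅a, (liftHom f b).snd⁆ - ⁅b, (liftHom f a).snd⁆
    rw [LieHom.map_lie, DL.lie_eq]
    simp only [liftHom_fst]
    rw [← lie_skew b]; abel

theorem der_of {Z : Type*} (f : Z → FreeLieAlgebra K Z) (z : Z) :
    der f (FreeLieAlgebra.of K z) = f z := by
  change (liftHom f (FreeLieAlgebra.of K z)).snd = f z
  simp [liftHom]

theorem sub_top {Z : Type*} (S : LieSubalgebra K (FreeLieAlgebra K Z))
    (h : ∀ z, FreeLieAlgebra.of K z ∈ S) (a : FreeLieAlgebra K Z) : a ∈ S := by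
  have e : S.incl.comp (FreeLieAlgebra.lift K (fun z => (⟨FreeLieAlgebra.of K z, h z⟩ : S)))
      = LieHom.id := by
    apply FreeLieAlgebra.hom_ext
    intro z
    simp
  have := LieHom.congr_fun e a
  rw [LieHom.id_apply] at this
  rw [← this]
  exact Subtype.property _

variable (K) (X Y : Type*)

abbrev W := (n : ℕ) × ((Fin n → Y) × X)

noncomputable def D (y : Y) :
    LieDerivation K (FreeLieAlgebra K (W X Y)) (FreeLieAlgebra K (W X Y)) :=
  der (fun w => FreeLieAlgebra.of K (⟨w.1 + 1, Fin.cons y w.2.1, w.2.2⟩ : W X Y))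

theorem D_of (y : Y) (w : W X Y) : D K X Y y (FreeLieAlgebra.of K w) =
    FreeLieAlgebra.of K (⟨w.1 + 1, Fin.cons y w.2.1, w.2.2⟩ : W X Y) := der_of _ _

noncomputable def ψ : FreeLieAlgebra K Y →ₗ⁅K⁆
    LieDerivation K (FreeLieAlgebra K (W X Y)) (FreeLieAlgebra K (W X Y)) :=
  FreeLieAlgebra.lift K (D K X Y)

noncomputable def Θ : FreeLieAlgebra K (X ⊕ Y) →ₗ⁅K⁆
    LieAlgebra.SemiDirectSum (FreeLieAlgebra K (W X Y)) (FreeLieAlgebra K Y) (ψ K X Y) :=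
  FreeLieAlgebra.lift K (Sum.elim
    (fun x => ⟨FreeLieAlgebra.of K (⟨0, Fin.elim0, x⟩ : W X Y), 0⟩)
    (fun y => ⟨0, FreeLieAlgebra.of K y⟩))

theorem Θ_iter (n : ℕ) (ys : Fin n → Y) (x : X) :
    Θ K X Y (iterBracket K X Y n ys x) = ⟨FreeLieAlgebra.of K (⟨n, ys, x⟩ : W X Y), 0⟩ := by
  induction n with
  | zero =>
    have : ys = Fin.elim0 := Subsingleton.elim _ _
    subst this
    simp [iterBracket, Θ]
  | succ n ih =>
    rw [iterBracket, LieHom.map_lie, ih]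
    have : Θ K X Y (FreeLieAlgebra.of K (Sum.inr (ys 0))) = ⟨0, FreeLieAlgebra.of K (ys 0)⟩ := by
      simp [Θ]
    rw [this]
    have h2 : (Fin.cons (ys 0) (fun i : Fin n => ys i.succ) : Fin (n+1) → Y) = ys :=
      Fin.cons_self_tail ys
    have h3 : ψ K X Y (FreeLieAlgebra.of K (ys 0)) = D K X Y (ys 0) := by simp [ψ]
    rw [LieAlgebra.SemiDirectSum.lie_eq_mk]
    simp only [h3, D_of, h2, zero_lie, lie_zero, map_zero, zero_add, sub_zero]

noncomputable def φ₀ : FreeLieAlgebra K (W X Y) →ₗ⁅K⁆ FreeLieAlgebra K (X ⊕ Y) :=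
  FreeLieAlgebra.lift K (fun w : W X Y => iterBracket K X Y w.1 w.2.1 w.2.2)

theorem φ₀_of (w : W X Y) :
    φ₀ K X Y (FreeLieAlgebra.of K w) = iterBracket K X Y w.1 w.2.1 w.2.2 := by
  simp [φ₀]

theorem φ₀_inj : Function.Injective (φ₀ K X Y) := by
  have h : (Θ K X Y).comp (φ₀ K X Y) = LieAlgebra.SemiDirectSum.inl (ψ K X Y) := by
    apply FreeLieAlgebra.hom_ext
    rintro ⟨n, ys, x⟩
    rw [LieHom.comp_apply, φ₀_of, Θ_iter]
    rfl
  intro a b hab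
  apply LieAlgebra.SemiDirectSum.inl_injective (ψ K X Y)
  rw [← h, LieHom.comp_apply, LieHom.comp_apply, hab]

theorem lie_inr (y : Y) (a : FreeLieAlgebra K (W X Y)) :
    ⁅FreeLieAlgebra.of K (Sum.inr y : X ⊕ Y), φ₀ K X Y a⁆ = φ₀ K X Y (D K X Y y a) := by
  let S : LieSubalgebra K (FreeLieAlgebra K (W X Y)) :=
    { carrier := {a | ⁅FreeLieAlgebra.of K (Sum.inr y : X ⊕ Y), φ₀ K X Y a⁆
        = φ₀ K X Y (D K X Y y a)}
      zero_mem' := by simp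
      add_mem' := by
        intro a b ha hb
        simp only [Set.mem_ofPred_eq] at *
        rw [map_add, map_add, map_add, lie_add, ha, hb]
      smul_mem' := by
        intro t a ha
        simp only [Set.mem_ofPred_eq] at *
        rw [map_smul, map_smul, map_smul, lie_smul, ha]
      lie_mem' := by
        intro a b ha hb
        change ⁅FreeLieAlgebra.of K (Sum.inr y : X ⊕ Y), φ₀ K X Y a⁆
          = φ₀ K X Y (D K X Y y a) at ha
        change ⁅FreeLieAlgebra.of K (Sum.inr y : X ⊕ Y), φ₀ K X Y b⁆
          = φ₀ K X Y (D K X Y y b) at hb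
        change ⁅FreeLieAlgebra.of K (Sum.inr y : X ⊕ Y), φ₀ K X Y ⁅a, b⁆⁆
          = φ₀ K X Y (D K X Y y ⁅a, b⁆)
        rw [LieDerivation.apply_lie_eq_add, LieHom.map_lie, leibniz_lie, map_add, ha, hb,
          LieHom.map_lie, LieHom.map_lie, add_comm] }
  refine sub_top S (fun w => ?_) a
  change ⁅FreeLieAlgebra.of K (Sum.inr y : X ⊕ Y), φ₀ K X Y _⁆ = φ₀ K X Y (D K X Y y _)
  rw [D_of, φ₀_of, φ₀_of]
  simp [iterBracket]

theorem range_normal (z a : FreeLieAlgebra K (X ⊕ Y)) (ha : a ∈ (φ₀ K X Y).range) :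
    ⁅z, a⁆ ∈ (φ₀ K X Y).range := by
  have h : z ∈ (φ₀ K X Y).range.normalizer := by
    apply sub_top
    rintro (x | y)
    · apply LieSubalgebra.le_normalizer
      rw [LieHom.mem_range]
      exact ⟨FreeLieAlgebra.of K (⟨0, Fin.elim0, x⟩ : W X Y), by rw [φ₀_of]; rfl⟩
    · rw [LieSubalgebra.mem_normalizer_iff]
      rintro _ ⟨b, rfl⟩
      exact (LieHom.mem_range _ _).2 ⟨_, (lie_inr K X Y y b).symm⟩
  exact (LieSubalgebra.mem_normalizer_iff _ _).1 h a ha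

theorem iter_mem (I : LieIdeal K (FreeLieAlgebra K (X ⊕ Y)))
    (h : ∀ x : X, FreeLieAlgebra.of K (Sum.inl x) ∈ I) (n : ℕ) (ys : Fin n → Y) (x : X) :
    iterBracket K X Y n ys x ∈ I := by
  induction n with
  | zero => exact h x
  | succ n ih => exact I.lie_mem (ih _)

end LazardElim

theorem stmt14 (K : Type*) [Field K] (X Y : Type*)
    (φ : FreeLieAlgebra K ((n : ℕ) × ((Fin n → Y) × X)) →ₗ⁅K⁆ FreeLieAlgebra K (X ⊕ Y))
    (hφ : φ = FreeLieAlgebra.lift K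
      (fun w : (n : ℕ) × ((Fin n → Y) × X) => iterBracket K X Y w.1 w.2.1 w.2.2))
    (I : LieIdeal K (FreeLieAlgebra K (X ⊕ Y)))
    (hI : I = LieSubmodule.lieSpan K (FreeLieAlgebra K (X ⊕ Y))
      (Set.range fun x : X => FreeLieAlgebra.of K (Sum.inl x))) :
    Function.Injective φ ∧ Set.range φ = (I : Set (FreeLieAlgebra K (X ⊕ Y))) := by
  have e : φ = LazardElim.φ₀ K X Y := hφ
  subst e
  refine ⟨LazardElim.φ₀_inj K X Y, Set.Subset.antisymm ?_ ?_⟩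
  · rintro _ ⟨a, rfl⟩
    have hx : ∀ x : X, FreeLieAlgebra.of K (Sum.inl x) ∈ I := by
      intro x
      rw [hI]
      exact LieSubmodule.subset_lieSpan ⟨x, rfl⟩
    have := LazardElim.sub_top ((LieIdeal.toLieSubalgebra K _ I).comap (LazardElim.φ₀ K X Y))
      (fun w => by
        change LazardElim.φ₀ K X Y _ ∈ I
        rw [LazardElim.φ₀_of]
        exact LazardElim.iter_mem K X Y I hx _ _ _) a
    exact this
  · let J : LieIdeal K (FreeLieAlgebra K (X ⊕ Y)) :=
      { (LazardElim.φ₀ K X Y).range.toSubmodule with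
        lie_mem := fun {z a} ha => LazardElim.range_normal K X Y z a ha }
    have hJ : I ≤ J := by
      rw [hI, LieSubmodule.lieSpan_le]
      rintro _ ⟨x, rfl⟩
      change _ ∈ (LazardElim.φ₀ K X Y).range
      rw [LieHom.mem_range]
      exact ⟨FreeLieAlgebra.of K (⟨0, Fin.elim0, x⟩ : LazardElim.W X Y), by
        rw [LazardElim.φ₀_of]; rfl⟩
    intro a ha
    have : a ∈ (LazardElim.φ₀ K X Y).range := hJ ha
    rwa [LieHom.mem_range] at this
end

section
/- Define c : ℕ → ℝ by c(0) = 2 and c(k+1) = c(k)² + 2. Then the sequence k ↦ c(k)^(1/2^k) converges to a real limit L satisfying 2.4832 < L < 2.4833. (L = r^{-1} is the reciprocal of the radius of convergence of the generating function of the Wedderburn–Etherington numbers, the growth rate of the number of modified potentials.) -/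
/-- The Wedderburn sequence `c 0 = 2`, `c (k+1) = (c k)² + 2`. -/
def wedderburnSeq : ℕ → ℝ
  | 0 => 2
  | k + 1 => wedderburnSeq k ^ 2 + 2

lemma wed_lower (k : ℕ) : (2.48325:ℝ) ^ (2 ^ (k+4)) ≤ wedderburnSeq (k+4) := by
  induction k with
  | zero => norm_num [wedderburnSeq]
  | succ k ih =>
    have h : wedderburnSeq (k+1+4) = wedderburnSeq (k+4) ^ 2 + 2 := rfl
    have e : (2:ℕ)^(k+1+4) = 2^(k+4)*2 := by ring
    rw [h, e, pow_mul]
    have := pow_le_pow_left₀ (by positivity) ih 2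
    linarith

lemma wed_upper (k : ℕ) : wedderburnSeq (k+4) + 1 ≤ (2.48326:ℝ) ^ (2 ^ (k+4)) := by
  induction k with
  | zero => norm_num [wedderburnSeq]
  | succ k ih =>
    have h : wedderburnSeq (k+1+4) = wedderburnSeq (k+4) ^ 2 + 2 := rfl
    have e : (2:ℕ)^(k+1+4) = 2^(k+4)*2 := by ring
    have h2 : (1:ℝ) ≤ wedderburnSeq (k+4) :=
      le_trans (one_le_pow₀ (by norm_num)) (wed_lower k)
    rw [h, e, pow_mul]
    have := pow_le_pow_left₀ (by linarith) ih 2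
    nlinarith

lemma wed_pos (k : ℕ) : 0 < wedderburnSeq k := by
  cases k with
  | zero => norm_num [wedderburnSeq]
  | succ k => simp only [wedderburnSeq]; positivity

lemma wed_root (a : ℝ) (ha : 0 ≤ a) (k : ℕ) : (a ^ (2^k : ℕ)) ^ (((2:ℝ)^k)⁻¹) = a := by
  have := Real.pow_rpow_inv_natCast ha (n := 2^k) (by positivity)
  simpa using this

lemma wed_mono : Monotone (fun k : ℕ => wedderburnSeq k ^ (((2 : ℝ) ^ k)⁻¹)) := by
  refine monotone_nat_of_le_succ fun k => ?_
  have hp := wed_pos k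
  have e : wedderburnSeq k ^ (((2 : ℝ) ^ k)⁻¹)
      = (wedderburnSeq k ^ 2) ^ (((2 : ℝ) ^ (k+1))⁻¹) := by
    rw [← Real.rpow_natCast (wedderburnSeq k) 2, ← Real.rpow_mul hp.le]
    congr 1
    rw [pow_succ]; push_cast; field_simp
  change wedderburnSeq k ^ (((2 : ℝ) ^ k)⁻¹) ≤ wedderburnSeq (k+1) ^ (((2 : ℝ) ^ (k+1))⁻¹)
  rw [e]
  apply Real.rpow_le_rpow (by positivity) _ (by positivity)
  simp only [wedderburnSeq]; linarith

lemma wed_ub (k : ℕ) : wedderburnSeq (k+4) ^ (((2 : ℝ) ^ (k+4))⁻¹) ≤ 2.48326 := by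
  rw [← wed_root 2.48326 (by norm_num) (k+4)]
  exact Real.rpow_le_rpow (wed_pos _).le (by linarith [wed_upper k]) (by positivity)

lemma wed_lb (k : ℕ) : 2.48325 ≤ wedderburnSeq (k+4) ^ (((2 : ℝ) ^ (k+4))⁻¹) := by
  rw [← wed_root 2.48325 (by norm_num) (k+4)]
  exact Real.rpow_le_rpow (by positivity) (wed_lower k) (by positivity)

theorem stmt15 :
    ∃ L : ℝ,
      Filter.Tendsto (fun k : ℕ => wedderburnSeq k ^ (((2 : ℝ) ^ k)⁻¹))
        Filter.atTop (nhds L) ∧ 2.4832 < L ∧ L < 2.4833 := by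
  have hb : BddAbove (Set.range (fun k : ℕ => wedderburnSeq k ^ (((2 : ℝ) ^ k)⁻¹))) := by
    refine ⟨2.48326, ?_⟩
    rintro _ ⟨k, rfl⟩
    exact (wed_mono (Nat.le_add_right k 4)).trans (wed_ub k)
  have ht := tendsto_atTop_ciSup wed_mono hb
  refine ⟨_, ht, ?_, ?_⟩
  · exact lt_of_lt_of_le (by norm_num) ((wed_lb 0).trans (le_ciSup hb 4))
  · refine lt_of_le_of_lt (b := 2.48326) (ciSup_le fun k => ?_) (by norm_num)
    exact (wed_mono (Nat.le_add_right k 4)).trans (wed_ub k)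
end

section
/- Define e : ℕ → ℝ by e(0) = 1 and e(k+1) = e(k)² + 2. Then the sequence k ↦ e(k)^(1/2^k) converges to a real limit L satisfying 1.8249 < L < 1.8250. (L = 1/α is the entropy of the Lie algebra of classical mechanics, where α is the smallest positive root of t + a(t²) = 1 for the binary-tree generating function a.) -/
/-- The sequence `e 0 = 1`, `e (k+1) = (e k)² + 2`. -/
def entropySeq : ℕ → ℝ
  | 0 => 1
  | k + 1 => entropySeq k ^ 2 + 2

theorem es_one_le (k : ℕ) : 1 ≤ entropySeq k := by
  induction k with
  | zero => simp [entropySeq]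
  | succ k ih => simp only [entropySeq]; nlinarith

theorem es_four : entropySeq 4 = 15131 := by
  norm_num [entropySeq]

theorem es_upper (k : ℕ) : entropySeq (k + 4) + 1 ≤ (1.82495 : ℝ) ^ (2 ^ (k + 4)) := by
  induction k with
  | zero => rw [Nat.zero_add, es_four]; norm_num
  | succ k ih =>
    have h1 := es_one_le (k + 4)
    have e1 : entropySeq (k + 1 + 4) = entropySeq (k + 4) ^ 2 + 2 := by
      rw [show k + 1 + 4 = (k + 4) + 1 by ring]; rfl
    have e2 : (2 : ℕ) ^ (k + 1 + 4) = 2 ^ (k + 4) * 2 := by ring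
    rw [e1, e2, pow_mul]
    have h2 : (entropySeq (k + 4) + 1) ^ 2 ≤ ((1.82495 : ℝ) ^ (2 ^ (k + 4))) ^ 2 :=
      pow_le_pow_left₀ (by linarith) ih 2
    nlinarith

theorem es_root (c : ℝ) (hc : 0 ≤ c) (k : ℕ) :
    (c ^ (2 ^ k : ℕ)) ^ (((2 : ℝ) ^ k)⁻¹) = c := by
  have := Real.pow_rpow_inv_natCast hc (n := 2 ^ k) (by positivity)
  push_cast at this
  exact this

theorem es_mono : Monotone (fun k : ℕ => entropySeq k ^ (((2 : ℝ) ^ k)⁻¹)) := by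
  refine monotone_nat_of_le_succ fun k => ?_
  have h1 := es_one_le k
  have h0 : 0 ≤ entropySeq k := by linarith
  have e : entropySeq k ^ (((2 : ℝ) ^ k)⁻¹)
      = (entropySeq k ^ 2) ^ (((2 : ℝ) ^ (k + 1))⁻¹) := by
    rw [← Real.rpow_natCast (entropySeq k) 2, ← Real.rpow_mul h0]
    congr 1
    rw [pow_succ]
    push_cast
    field_simp
  rw [e]
  refine Real.rpow_le_rpow (by positivity) ?_ (by positivity)
  simp only [entropySeq]
  linarith

theorem es_bound (k : ℕ) : entropySeq k ^ (((2 : ℝ) ^ k)⁻¹) ≤ 1.82495 := by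
  refine (es_mono (Nat.le_add_right k 4)).trans ?_
  simp only
  have h1 := es_one_le (k + 4)
  calc _ ≤ ((1.82495 : ℝ) ^ (2 ^ (k + 4) : ℕ)) ^ (((2 : ℝ) ^ (k + 4))⁻¹) :=
        Real.rpow_le_rpow (by linarith) (by linarith [es_upper k]) (by positivity)
    _ = _ := es_root _ (by norm_num) _

theorem stmt16 :
    ∃ L : ℝ,
      Filter.Tendsto (fun k : ℕ => entropySeq k ^ (((2 : ℝ) ^ k)⁻¹))
        Filter.atTop (nhds L) ∧ 1.8249 < L ∧ L < 1.8250 := by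
  have hb : BddAbove (Set.range (fun k : ℕ => entropySeq k ^ (((2 : ℝ) ^ k)⁻¹))) :=
    ⟨1.82495, by rintro _ ⟨k, rfl⟩; exact es_bound k⟩
  refine ⟨_, tendsto_atTop_ciSup es_mono hb, ?_, ?_⟩
  · refine lt_of_lt_of_le ?_ (le_ciSup hb 4)
    rw [es_four]
    have h := es_root 1.8249 (by norm_num) 4
    rw [← h]
    exact Real.rpow_lt_rpow (by positivity) (by norm_num) (by positivity)
  · exact lt_of_le_of_lt (ciSup_le es_bound) (by norm_num)
end
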